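/- Fix β > 0 and r > 0, and define f(ε) = π/β + (r² − 1/β)·arcsin(r/(r+ε)) + r·√(2rε + ε²) − (π/2) r² for ε > 0. Then as ε → 0⁺, f(ε) = π/(2β) + (√2/(β√r))·ε^{1/2} + ((8βr² − 5)/(6√2 · β · r^{3/2}))·ε^{3/2} + O(ε²); i.e. there exist δ > 0 and C > 0 such that |f(ε) − π/(2β) − (√2/(β√r))ε^{1/2} − ((8βr² − 5)/(6√2 β r^{3/2}))ε^{3/2}| ≤ C ε² for all ε ∈ (0, δ). -/

import Mathlib

open Real

lemma aux_arctan (s : ℝ) (hs : 0 ≤ s) :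
    0 ≤ Real.arctan s - s + s ^ 3 / 3 ∧ Real.arctan s - s + s ^ 3 / 3 ≤ s ^ 5 / 5 := by
  have h1 : ∀ x : ℝ, HasDerivAt (fun x : ℝ => Real.arctan x - x + x ^ 3 / 3)
      (x ^ 4 / (1 + x ^ 2)) x := by
    intro x
    have h := ((Real.hasDerivAt_arctan x).sub (hasDerivAt_id x)).add
      ((hasDerivAt_pow 3 x).div_const 3)
    refine h.congr_deriv ?_
    have : 1 + x ^ 2 ≠ 0 := by positivity
    field_simp
    push_cast
    ring
  have h2 : ∀ x : ℝ, HasDerivAt (fun x : ℝ => x ^ 5 / 5 - (Real.arctan x - x + x ^ 3 / 3))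
      (x ^ 6 / (1 + x ^ 2)) x := by
    intro x
    have h := ((hasDerivAt_pow 5 x).div_const 5).sub (h1 x)
    refine h.congr_deriv ?_
    have : 1 + x ^ 2 ≠ 0 := by positivity
    field_simp
    push_cast
    ring
  have m1 : Monotone (fun x : ℝ => Real.arctan x - x + x ^ 3 / 3) :=
    monotone_of_deriv_nonneg (fun x => (h1 x).differentiableAt)
      (fun x => by rw [(h1 x).deriv]; positivity)
  have m2 : Monotone (fun x : ℝ => x ^ 5 / 5 - (Real.arctan x - x + x ^ 3 / 3)) :=
    monotone_of_deriv_nonneg (fun x => (h2 x).differentiableAt)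
      (fun x => by rw [(h2 x).deriv]; positivity)
  have a1 := m1 hs
  have a2 := m2 hs
  simp at a1 a2
  constructor <;> linarith

lemma aux_arcsin (u s : ℝ) (h0 : 0 ≤ s) (hs : s ^ 2 = 2 * u ^ 2 + u ^ 4) :
    Real.arcsin (1 / (1 + u ^ 2)) = π / 2 - Real.arctan s := by
  apply Real.arcsin_eq_of_sin_eq
  · rw [Real.sin_pi_div_two_sub, Real.cos_arctan, hs,
      show 1 + (2 * u ^ 2 + u ^ 4) = (1 + u ^ 2) ^ 2 by ring, Real.sqrt_sq (by positivity)]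
  · have h1 := Real.arctan_lt_pi_div_two s
    have h2 : 0 ≤ Real.arctan s := Real.arctan_nonneg.2 h0
    constructor <;> linarith [Real.pi_pos]

lemma aux_s (u w q : ℝ) (hu : 0 < u) (hu1 : u < 1) (hw : 0 ≤ w) (hw2 : w ^ 2 = 1 + u ^ 2 / 2)
    (hq : 0 ≤ q) (hq2 : q ^ 2 = 2) :
    (q * u * w) ^ 5 / 5 ≤ 7 * u ^ 4 ∧ |q * u * w - q * u - q * u ^ 3 / 4| ≤ u ^ 4 ∧
    |(q * u * w) ^ 3 / 3 - 2 * q * u ^ 3 / 3| ≤ 2 * u ^ 4 := by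
  have hq1 : q ≤ 3 / 2 := by nlinarith
  have hu2 : u ^ 2 ≤ 1 := by nlinarith
  have hw1 : 1 ≤ w := by nlinarith [sq_nonneg u]
  have hwu : w ≤ 1 + u ^ 2 / 4 := by
    refine abs_le_of_sq_le_sq' ?_ (by positivity) |>.2
    nlinarith [sq_nonneg (u ^ 2)]
  have hwl : 1 + u ^ 2 / 4 - w ≤ u ^ 4 / 32 := by
    have : (1 + u ^ 2 / 4 - w) * (1 + u ^ 2 / 4 + w) = u ^ 4 / 16 := by
      linear_combination -hw2
    nlinarith [sq_nonneg u]
  have hu5 : u ^ 5 ≤ u ^ 4 := pow_le_pow_of_le_one hu.le hu1.le (by norm_num)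
  have hqw : q * w ≤ 2 := by
    refine abs_le_of_sq_le_sq' ?_ (by norm_num) |>.2
    rw [mul_pow, hq2, hw2]; linarith
  refine ⟨?_, ?_, ?_⟩
  · have : (q * w) ^ 5 ≤ 2 ^ 5 := pow_le_pow_left₀ (by positivity) hqw 5
    have h := mul_le_mul_of_nonneg_right this (by positivity : 0 ≤ u ^ 5)
    have e : (q * u * w) ^ 5 = (q * w) ^ 5 * u ^ 5 := by ring
    rw [e]; linarith
  · have e : q * u * w - q * u - q * u ^ 3 / 4 = -(q * u * (1 + u ^ 2 / 4 - w)) := by ring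
    have hqu : q * u ≤ 3 / 2 := by nlinarith
    rw [e, abs_neg, abs_of_nonneg (mul_nonneg (by positivity) (by linarith))]
    have := mul_le_mul hqu hwl (by linarith) (by norm_num)
    have : 0 ≤ u ^ 4 := by positivity
    linarith
  · have e : (q * u * w) ^ 3 / 3 - 2 * q * u ^ 3 / 3 = 2 * q / 3 * (u ^ 3 * (w ^ 3 - 1)) := by
      linear_combination (q * u ^ 3 * w ^ 3 / 3) * hq2
    have h1 : 1 ≤ w ^ 3 := one_le_pow₀ hw1
    have h2 : w ^ 3 ≤ w ^ 4 := pow_le_pow_right₀ hw1 (by norm_num)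
    have h4 : w ^ 4 = 1 + u ^ 2 + u ^ 4 / 4 := by
      rw [show w ^ 4 = (w ^ 2) ^ 2 by ring, hw2]; ring
    have h5 : w ^ 3 - 1 ≤ 5 / 4 * u ^ 2 := by nlinarith [sq_nonneg u]
    have h6 := mul_le_mul_of_nonneg_left h5 (by positivity : 0 ≤ u ^ 3)
    have h7 : 0 ≤ u ^ 3 * (w ^ 3 - 1) := mul_nonneg (by positivity) (by linarith)
    rw [e, abs_of_nonneg (by positivity)]
    have := mul_le_mul (by linarith : 2 * q / 3 ≤ 1) h6 h7 (by norm_num)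
    have : 0 ≤ u ^ 4 := by positivity
    linarith

/-- Asymptotic expansion of the connectivity mass near a small circular obstacle:
with `f(ε) = π/β + (r² − 1/β)·arcsin(r/(r+ε)) + r·√(2rε + ε²) − (π/2) r²`, as `ε → 0⁺`,
`f(ε) = π/(2β) + (√2/(β√r))·ε^{1/2} + ((8βr² − 5)/(6√2 β r^{3/2}))·ε^{3/2} + O(ε²)`. -/
theorem mass_small_obstacle_expansion (β r : ℝ) (hβ : 0 < β) (hr : 0 < r)
    (f : ℝ → ℝ)
    (hf : ∀ ε > (0 : ℝ), f ε = π / β + (r ^ 2 - 1 / β) * Real.arcsin (r / (r + ε))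
        + r * Real.sqrt (2 * r * ε + ε ^ 2) - π / 2 * r ^ 2) :
    ∃ δ > (0 : ℝ), ∃ C > (0 : ℝ), ∀ ε : ℝ, 0 < ε → ε < δ →
      |f ε - π / (2 * β) - Real.sqrt 2 / (β * Real.sqrt r) * Real.sqrt ε
          - (8 * β * r ^ 2 - 5) / (6 * Real.sqrt 2 * β * (r * Real.sqrt r))
            * (ε * Real.sqrt ε)|
        ≤ C * ε ^ 2 := by
  refine ⟨r, hr, (9 * |1 / β - r ^ 2| + 1 / β) / r ^ 2, by positivity, ?_⟩
  intro ε hε hεr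
  rw [hf ε hε]
  obtain ⟨u, hu, rfl⟩ : ∃ u : ℝ, 0 < u ∧ ε = r * u ^ 2 := by
    refine ⟨√(ε / r), Real.sqrt_pos.2 (by positivity), ?_⟩
    rw [Real.sq_sqrt (by positivity)]; field_simp
  have hu1 : u < 1 := by
    by_contra h
    push Not at h
    nlinarith [mul_le_mul_of_nonneg_left (one_le_pow₀ h : 1 ≤ u ^ 2) hr.le]
  have hw2 := Real.sq_sqrt (by positivity : 0 ≤ 1 + u ^ 2 / 2)
  have hw := Real.sqrt_nonneg (1 + u ^ 2 / 2)
  have hq2 := Real.sq_sqrt (by norm_num : (0 : ℝ) ≤ 2)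
  have hq : 0 < √(2 : ℝ) := by positivity
  have ha : 0 < √r := by positivity
  have hsε : √(r * u ^ 2) = √r * u := by rw [Real.sqrt_mul hr.le, Real.sqrt_sq hu.le]
  set w := √(1 + u ^ 2 / 2)
  rw [hsε]
  generalize √(2 : ℝ) = q at *
  have hs2 : (q * u * w) ^ 2 = 2 * u ^ 2 + u ^ 4 := by
    rw [mul_pow, mul_pow, hq2, hw2]; ring
  have hsq : √(2 * r * (r * u ^ 2) + (r * u ^ 2) ^ 2) = r * (q * u * w) := by
    rw [show 2 * r * (r * u ^ 2) + (r * u ^ 2) ^ 2 = (r * (q * u * w)) ^ 2 by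
      rw [mul_pow r (q * u * w), hs2]; ring]
    exact Real.sqrt_sq (by positivity)
  have hdiv : r / (r + r * u ^ 2) = 1 / (1 + u ^ 2) := by field_simp
  rw [hsq, hdiv, aux_arcsin u _ (by positivity) hs2]
  obtain ⟨b1, b2, b3⟩ := aux_s u w q hu hu1 hw hw2 hq.le hq2
  obtain ⟨c1, c2⟩ := aux_arctan (q * u * w) (by positivity)
  generalize √r = a at *
  have t1 : q / (β * a) * (a * u) = 1 / β * (q * u) := by field_simp
  have t2 : (8 * β * r ^ 2 - 5) / (6 * q * β * (r * a)) * (r * u ^ 2 * (a * u))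
      = (2 / 3 * r ^ 2 - 5 / 12 * (1 / β)) * (q * u ^ 3) := by
    field_simp
    rw [hq2]; ring
  have t3 : π / β = π * (1 / β) := by ring
  have t4 : π / (2 * β) = π / 2 * (1 / β) := by field_simp
  have t5 : (9 * |1 / β - r ^ 2| + 1 / β) / r ^ 2 * (r * u ^ 2) ^ 2
      = (9 * |1 / β - r ^ 2| + 1 / β) * u ^ 4 := by field_simp
  rw [t1, t2, t3, t4, t5]
  have hK : 0 < 1 / β := by positivity
  generalize 1 / β = K at *
  have e : π * K + (r ^ 2 - K) * (π / 2 - Real.arctan (q * u * w)) + r * (r * (q * u * w))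
      - π / 2 * r ^ 2 - π / 2 * K - K * (q * u)
      - (2 / 3 * r ^ 2 - 5 / 12 * K) * (q * u ^ 3)
      = (K - r ^ 2) * (Real.arctan (q * u * w) - q * u * w + (q * u * w) ^ 3 / 3)
        + K * (q * u * w - q * u - q * u ^ 3 / 4)
        - (K - r ^ 2) * ((q * u * w) ^ 3 / 3 - 2 * q * u ^ 3 / 3) := by ring
  rw [e]
  refine (abs_sub _ _).trans ((add_le_add_left (abs_add_le _ _) _).trans ?_)
  rw [abs_mul, abs_mul, abs_mul, abs_of_pos hK, abs_of_nonneg c1]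
  have d1 := mul_le_mul_of_nonneg_left (c2.trans b1) (abs_nonneg (K - r ^ 2))
  have d2 := mul_le_mul_of_nonneg_left b2 hK.le
  have d3 := mul_le_mul_of_nonneg_left b3 (abs_nonneg (K - r ^ 2))
  linarith
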